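/- (Brjuno's theorem) Let θ ∈ (0,1) be irrational with convergents p_n/q_n and suppose B(θ) = Σ_n log(q_{n+1})/q_n < ∞. Let f be a function holomorphic on a neighborhood of 0 in ℂ with f(0) = 0 and f'(0) = e^{2πiθ}. Then f is linearizable at 0: there exist r > 0 and an injective holomorphic map ψ on the open disk B(0,r) with ψ(0) = 0, ψ'(0) = 1, and f(ψ(z)) = ψ(e^{2πiθ}·z) for all z ∈ B(0,r). -/

import Mathlib

open scoped Real ENNReal
open Filter

/-- The Gauss-map iterates: `alphaIter θ k` is `α_{k+1}(θ)`, i.e. `alphaIter θ 0 = α_1(θ) = θ`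
and `α_{i+1}(θ)` is the fractional part of `1/α_i(θ)`. -/
noncomputable def alphaIter (θ : ℝ) : ℕ → ℝ
  | 0 => θ
  | k + 1 => Int.fract (1 / alphaIter θ k)

/-- `HasCF θ a` : `θ` is an irrational number in `(0,1)` whose continued fraction digits
are given by `a` (0-indexed: `a k` is the digit `a_{k+1}` in 1-indexed notation). -/
def HasCF (θ : ℝ) (a : ℕ → ℕ) : Prop :=
  θ ∈ Set.Ioo (0 : ℝ) 1 ∧ Irrational θ ∧ ∀ k, ⌊1 / alphaIter θ k⌋ = (a k : ℤ)

/-- Yoccoz's Brjuno function `Φ(θ) = Σ_{n≥1} α_1(θ)⋯α_{n-1}(θ)·log(1/α_n(θ))`,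
as a real-valued sum. -/
noncomputable def brjunoPhi (θ : ℝ) : ℝ :=
  ∑' k : ℕ, (∏ j ∈ Finset.range k, alphaIter θ j) * Real.log (1 / alphaIter θ k)

/-- Yoccoz's Brjuno function with values in `ℝ≥0∞` (all terms are nonnegative). -/
noncomputable def brjunoPhiE (θ : ℝ) : ℝ≥0∞ :=
  ∑' k : ℕ, ENNReal.ofReal ((∏ j ∈ Finset.range k, alphaIter θ j) * Real.log (1 / alphaIter θ k))

/-- Digits of the noble number `ω = [a_1,…,a_n,1,1,1,…]`. -/
def nobleDigits (n : ℕ) (a : ℕ → ℕ) : ℕ → ℕ := fun k => if k < n then a k else 1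

/-- Digits of `β^N = [a_1,…,a_n,1,…,1,N,1,1,…]`, with `N` in (1-indexed) position `n+m`. -/
def betaDigits (n m N : ℕ) (a : ℕ → ℕ) : ℕ → ℕ :=
  fun k => if k + 1 = n + m then N else if k < n then a k else 1

/-- Digits of `β^I = [a_1,…,a_n,1,…,1,b_{n+m},b_{n+m+1},…]`: the digits of the noble number
with the whole tail from (1-indexed) position `n+m` on replaced by the tail `b`. -/
def tailDigits (n m : ℕ) (a b : ℕ → ℕ) : ℕ → ℕ :=
  fun k => if k + 1 < n + m then (if k < n then a k else 1) else b k

/-- The continued fraction denominators `q_n` built from the digit sequence `a`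
(0-indexed digits: `a 0 = a_1`): `q_0 = 1`, `q_1 = a_1`, `q_{n+1} = a_{n+1}·q_n + q_{n-1}`. -/
def qden (a : ℕ → ℕ) : ℕ → ℕ
  | 0 => 1
  | 1 => a 0
  | (k + 2) => a (k + 1) * qden a (k + 1) + qden a k

/-- The numerators of the convergents of the continued fraction with digits `a`. -/
def qnum (a : ℕ → ℕ) : ℕ → ℕ
  | 0 => 0
  | 1 => 1
  | (k + 2) => a (k + 1) * qnum a (k + 1) + qnum a k

/-- The product `α_1 ⋯ α_{k+1}` of the first Gauss-map iterates. -/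
noncomputable def alphaProd (θ : ℝ) (k : ℕ) : ℝ := ∏ j ∈ Finset.range (k + 1), alphaIter θ j

theorem alphaProd_zero (θ : ℝ) : alphaProd θ 0 = θ := by
  simp [alphaProd, alphaIter]

theorem alphaProd_succ (θ : ℝ) (k : ℕ) :
    alphaProd θ (k + 1) = alphaProd θ k * alphaIter θ (k + 1) :=
  Finset.prod_range_succ _ _

namespace HasCF

variable {θ : ℝ} {a : ℕ → ℕ}

theorem irrational_alphaIter (h : HasCF θ a) (k : ℕ) : Irrational (alphaIter θ k) := by
  induction k with
  | zero => exact h.2.1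
  | succ k ih =>
    have : Irrational (1 / alphaIter θ k - (⌊1 / alphaIter θ k⌋ : ℤ)) := by
      rw [one_div]
      exact ih.inv.sub_intCast _
    exact this

theorem alphaIter_mem (h : HasCF θ a) (k : ℕ) : alphaIter θ k ∈ Set.Ioo (0 : ℝ) 1 := by
  cases k with
  | zero => exact h.1
  | succ k =>
    refine ⟨lt_of_le_of_ne (Int.fract_nonneg _) ?_, Int.fract_lt_one _⟩
    exact (h.irrational_alphaIter (k + 1)).ne_zero.symm

theorem alphaIter_succ (h : HasCF θ a) (k : ℕ) :
    alphaIter θ (k + 1) = 1 / alphaIter θ k - a k := by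
  have := h.2.2 k
  rw [alphaIter, Int.fract, this, Int.cast_natCast]

theorem digit_pos (h : HasCF θ a) (k : ℕ) : 0 < a k := by
  have hk := h.alphaIter_mem k
  have h1 : (1 : ℤ) ≤ ⌊1 / alphaIter θ k⌋ := by
    rw [Int.le_floor, Int.cast_one]
    exact (one_le_div hk.1).2 hk.2.le
  rw [h.2.2 k] at h1
  exact_mod_cast h1

theorem qden_pos (h : HasCF θ a) : ∀ k, 0 < qden a k
  | 0 => by simp [qden]
  | 1 => by simpa [qden] using h.digit_pos 0
  | k + 2 => by
    rw [qden]
    exact Nat.add_pos_right _ (h.qden_pos k)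

theorem self_le_qden (h : HasCF θ a) : ∀ k, k ≤ qden a k
  | 0 => by simp
  | 1 => h.qden_pos 1
  | k + 2 => by
    have h1 := h.self_le_qden (k + 1)
    have h2 := h.qden_pos k
    have h3 := Nat.le_mul_of_pos_left (qden a (k + 1)) (h.digit_pos (k + 1))
    rw [qden]
    omega

theorem alphaProd_pos (h : HasCF θ a) (k : ℕ) : 0 < alphaProd θ k :=
  Finset.prod_pos fun j _ => (h.alphaIter_mem j).1

theorem alphaProd_add_two (h : HasCF θ a) (k : ℕ) :
    alphaProd θ (k + 2) = alphaProd θ k - a (k + 1) * alphaProd θ (k + 1) := by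
  have h1 := (h.alphaIter_mem (k + 1)).1.ne'
  rw [alphaProd_succ, h.alphaIter_succ (k + 1), alphaProd_succ θ k]
  field_simp

theorem alphaProd_one (h : HasCF θ a) : alphaProd θ 1 = 1 - a 0 * θ := by
  have h1 : θ ≠ 0 := h.1.1.ne'
  rw [alphaProd_succ, h.alphaIter_succ 0, alphaProd_zero, alphaIter]
  field_simp

theorem qden_mul_sub_qnum (h : HasCF θ a) :
    ∀ k, (qden a k : ℝ) * θ - qnum a k = (-1) ^ k * alphaProd θ k
  | 0 => by simp [qden, qnum, alphaProd_zero]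
  | 1 => by simp [qden, qnum, h.alphaProd_one]
  | k + 2 => by
    have h1 := h.qden_mul_sub_qnum k
    have h2 := h.qden_mul_sub_qnum (k + 1)
    rw [qden, qnum, h.alphaProd_add_two]
    push_cast
    linear_combination (a (k + 1) : ℝ) * h2 + h1

theorem qden_mul_alphaProd_add (h : HasCF θ a) (k : ℕ) :
    (qden a (k + 1) : ℝ) * alphaProd θ k + qden a k * alphaProd θ (k + 1) = 1 := by
  induction k with
  | zero => simp [qden, alphaProd_zero, h.alphaProd_one]
  | succ k ih =>
    rw [qden, h.alphaProd_add_two]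
    push_cast
    linear_combination ih

end HasCF

theorem qnum_mul_qden_sub (a : ℕ → ℕ) (k : ℕ) :
    (qnum a (k + 1) : ℤ) * qden a k - qnum a k * qden a (k + 1) = (-1) ^ k := by
  induction k with
  | zero => simp [qnum, qden]
  | succ k ih =>
    rw [qden, qnum, pow_succ, ← ih]
    push_cast
    ring

theorem isCoprime_qden_qnum (a : ℕ → ℕ) (k : ℕ) :
    IsCoprime (qden a k : ℤ) (qnum a k : ℤ) := by
  have h := qnum_mul_qden_sub a k
  have hs : ((-1 : ℤ) ^ k) * (-1) ^ k = 1 := by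
    rw [← mul_pow]; simp
  exact ⟨(-1) ^ k * qnum a (k + 1), -((-1) ^ k * qden a (k + 1)), by
    linear_combination ((-1 : ℤ) ^ k) * h + hs⟩

theorem HasCF.inv_two_mul_qden_le {θ : ℝ} {a : ℕ → ℕ} (h : HasCF θ a) (k d : ℕ) (hd : 0 < d)
    (hdk : 2 * d ≤ qden a k) (p : ℤ) : 1 / (2 * qden a k : ℝ) ≤ |d * θ - p| := by
  have hq : (0 : ℝ) < qden a k := by exact_mod_cast h.qden_pos k
  have hq1 : (0 : ℝ) < qden a (k + 1) := by exact_mod_cast h.qden_pos (k + 1)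
  have hne : (d * qnum a k - p * qden a k : ℤ) ≠ 0 := by
    intro h0
    have hdvd : (qden a k : ℤ) ∣ d * qnum a k := ⟨p, by linear_combination h0⟩
    have hdvd' := (isCoprime_qden_qnum a k).dvd_of_dvd_mul_right hdvd
    have := Nat.le_of_dvd hd (Int.natCast_dvd_natCast.1 hdvd')
    omega
  have hone : (1 : ℝ) ≤ |(d : ℝ) * qnum a k - p * qden a k| := by
    exact_mod_cast Int.one_le_abs hne
  have hmono : (qden a k : ℝ) ≤ qden a (k + 1) := by
    cases k with
    | zero => exact_mod_cast h.qden_pos 1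
    | succ k =>
      have h3 := Nat.le_mul_of_pos_left (qden a (k + 1)) (h.digit_pos (k + 1))
      have : qden a (k + 1) ≤ qden a (k + 1 + 1) := by rw [qden]; omega
      exact_mod_cast this
  have hprod : (qden a k : ℝ) * alphaProd θ k ≤ 1 := by
    have h1 := h.qden_mul_alphaProd_add k
    have h2 := mul_pos hq (h.alphaProd_pos (k + 1))
    have h3 := mul_le_mul_of_nonneg_right hmono (h.alphaProd_pos k).le
    linarith
  have habs : |(qden a k : ℝ) * θ - qnum a k| = alphaProd θ k := by
    rw [h.qden_mul_sub_qnum k, abs_mul, abs_pow, abs_neg, abs_one, one_pow, one_mul,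
      abs_of_pos (h.alphaProd_pos k)]
  have hdk' : 2 * (d : ℝ) ≤ qden a k := by exact_mod_cast hdk
  have htri : |(d : ℝ) * qnum a k - p * qden a k| ≤
      qden a k * |d * θ - p| + d * alphaProd θ k := by
    rw [← habs]
    have e : (d : ℝ) * qnum a k - p * qden a k =
        qden a k * (d * θ - p) - d * (qden a k * θ - qnum a k) := by ring
    rw [e]
    refine (abs_sub _ _).trans ?_
    rw [abs_mul, abs_mul, abs_of_pos hq, Nat.abs_cast]
  have hsmall : 2 * (d * alphaProd θ k) ≤ 1 := by
    have := mul_le_mul_of_nonneg_right hdk' (h.alphaProd_pos k).le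
    linarith
  rw [div_le_iff₀ (by positivity)]
  linarith

/-- Multiplicative form of Jordan's inequality on the unit circle. -/
theorem four_mul_abs_sub_round_le_norm_exp_sub_one (x : ℝ) :
    4 * |x - round x| ≤ ‖Complex.exp (2 * Real.pi * Complex.I * x) - 1‖ := by
  set y := x - round x with hy
  have hexp : Complex.exp (2 * Real.pi * Complex.I * x) =
      Complex.exp (Complex.I * (2 * Real.pi * y : ℝ)) := by
    rw [Complex.exp_eq_exp_iff_exists_int]
    refine ⟨round x, ?_⟩
    rw [hy]
    push_cast
    ring
  have hle : |y| ≤ 1 / 2 := abs_sub_round x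
  have hpi := Real.pi_pos
  have hsin := Real.mul_le_sin (x := Real.pi * |y|) (by positivity) (by nlinarith)
  have e : 2 / Real.pi * (Real.pi * |y|) = 2 * |y| := by field_simp
  rw [e] at hsin
  rw [hexp, Complex.norm_exp_I_mul_ofReal_sub_one, Real.norm_eq_abs, abs_mul, abs_two]
  have e2 : 2 * Real.pi * y / 2 = Real.pi * y := by ring
  have h3 : Real.sin (Real.pi * |y|) ≤ |Real.sin (Real.pi * y)| := by
    rcases abs_cases y with ⟨h, _⟩ | ⟨h, _⟩
    · rw [h]; exact le_abs_self _
    · rw [h, mul_neg, Real.sin_neg]; exact neg_le_abs _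
  rw [e2]
  linarith

theorem HasCF.two_div_qden_le_norm_pow_sub_one {θ : ℝ} {a : ℕ → ℕ} (h : HasCF θ a) (k d : ℕ)
    (hd : 0 < d) (hdk : 2 * d ≤ qden a k) :
    2 / (qden a k : ℝ) ≤ ‖Complex.exp (2 * Real.pi * Complex.I * θ) ^ d - 1‖ := by
  have h1 := h.inv_two_mul_qden_le k d hd hdk (round (d * θ))
  have h2 := four_mul_abs_sub_round_le_norm_exp_sub_one (d * θ)
  have e : Complex.exp (2 * Real.pi * Complex.I * θ) ^ d =
      Complex.exp (2 * Real.pi * Complex.I * (d * θ : ℝ)) := by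
    rw [← Complex.exp_nat_mul]
    push_cast
    ring_nf
  rw [e]
  have e3 : 2 / (qden a k : ℝ) = 4 * (1 / (2 * qden a k)) := by ring
  linarith

theorem norm_exp_two_pi_mul_I_mul (θ : ℝ) : ‖Complex.exp (2 * Real.pi * Complex.I * θ)‖ = 1 := by
  have e : 2 * Real.pi * Complex.I * θ = ((2 * Real.pi * θ : ℝ) : ℂ) * Complex.I := by
    push_cast; ring
  rw [e, Complex.norm_exp_ofReal_mul_I]

theorem HasCF.exp_pow_succ_ne_one {θ : ℝ} {a : ℕ → ℕ} (h : HasCF θ a) (n : ℕ) :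
    Complex.exp (2 * Real.pi * Complex.I * θ) ^ (n + 1) ≠ 1 := by
  intro h1
  have hk : 2 * (n + 1) ≤ qden a (2 * (n + 1)) := h.self_le_qden _
  have hq : (0 : ℝ) < qden a (2 * (n + 1)) := by exact_mod_cast h.qden_pos _
  have h2 := h.two_div_qden_le_norm_pow_sub_one _ (n + 1) n.succ_pos hk
  rw [h1, sub_self, norm_zero] at h2
  exact absurd h2 (not_le.2 (div_pos two_pos hq))

/-- The first element of `S` after `n`, capped at `n + Q`. -/
noncomputable def nextElement (S : Set ℕ) (Q n : ℕ) : ℕ := sInf {s | n < s ∧ (s ∈ S ∨ s = n + Q)}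

theorem nextElement_mem (S : Set ℕ) {Q : ℕ} (hQ : 0 < Q) (n : ℕ) :
    n < nextElement S Q n ∧ (nextElement S Q n ∈ S ∨ nextElement S Q n = n + Q) :=
  Nat.sInf_mem (s := {s | n < s ∧ (s ∈ S ∨ s = n + Q)}) ⟨n + Q, by omega, Or.inr rfl⟩

theorem nextElement_le {S : Set ℕ} {Q n s : ℕ} (h : n < s) (hs : s ∈ S ∨ s = n + Q) :
    nextElement S Q n ≤ s :=
  Nat.sInf_le ⟨h, hs⟩

/-- A superadditive function that increases by at least `Q` at each element of a set `S` whose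
elements are separated by gaps of length at least `Q / 2`. -/
noncomputable def davieCount (S : Set ℕ) (Q n : ℕ) : ℕ :=
  if 2 * n < Q then 0 else min (4 * n - Q) (4 * nextElement S Q n - 2 * Q)

section DavieCount

variable {S : Set ℕ} {Q : ℕ}

theorem davieCount_le (n : ℕ) : davieCount S Q n ≤ 4 * n := by
  unfold davieCount
  split_ifs <;> omega

theorem davieCount_le_succ (hQ : 0 < Q) (n : ℕ) : davieCount S Q n ≤ davieCount S Q (n + 1) := by
  have h1 := nextElement_mem S hQ (n + 1)
  have h2 : nextElement S Q n ≤ nextElement S Q (n + 1) := by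
    rcases h1.2 with h | h
    · exact nextElement_le (by omega) (Or.inl h)
    · have := nextElement_le (S := S) (Q := Q) (n := n) (s := n + Q) (by omega) (Or.inr rfl)
      omega
  unfold davieCount
  split_ifs <;> omega

theorem davieCount_mono (hQ : 0 < Q) : Monotone (davieCount S Q) :=
  monotone_nat_of_le_succ (davieCount_le_succ hQ)

theorem davieCount_add_le (hQ : 0 < Q) (n m : ℕ) :
    davieCount S Q n + davieCount S Q m ≤ davieCount S Q (n + m) := by
  by_cases hn : 2 * n < Q
  · have h0 : davieCount S Q n = 0 := if_pos hn
    have := davieCount_mono (S := S) hQ (Nat.le_add_left m n)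
    omega
  by_cases hm : 2 * m < Q
  · have h0 : davieCount S Q m = 0 := if_pos hm
    have := davieCount_mono (S := S) hQ (Nat.le_add_right n m)
    omega
  have h1 := (nextElement_mem S hQ (n + m)).1
  unfold davieCount
  split_ifs <;> omega

theorem davieCount_add_le_succ (hQ : 0 < Q) (hS : ∀ s ∈ S, Q ≤ 2 * s)
    (hSS : ∀ s ∈ S, ∀ t ∈ S, s < t → Q ≤ 2 * (t - s)) {n : ℕ} (hn : n + 1 ∈ S) :
    davieCount S Q n + Q ≤ davieCount S Q (n + 1) := by
  have h0 := hS _ hn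
  have h1 : nextElement S Q n ≤ n + 1 := nextElement_le (by omega) (Or.inl hn)
  have h2 := nextElement_mem S hQ (n + 1)
  have h3 : 2 * (n + 1) + Q ≤ 2 * nextElement S Q (n + 1) := by
    rcases h2.2 with h | h
    · have := hSS _ hn _ h h2.1
      omega
    · omega
  unfold davieCount
  split_ifs <;> omega

end DavieCount

/-- Davie's lemma: a superadditive function of linear growth whose increments dominate the
logarithms of the small divisors. -/
theorem exists_davie_function (θ : ℝ) (a : ℕ → ℕ) (hθ : HasCF θ a)
    (hB : (∑' k : ℕ, ENNReal.ofReal (Real.log (qden a (k + 1)) / qden a k)) < ⊤) :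
    ∃ (K : ℕ → ℝ) (M : ℝ), (∀ n, 0 ≤ K n) ∧ (∀ n, K n ≤ M * n) ∧
      (∀ m n, K m + K n ≤ K (m + n)) ∧
      ∀ n, ‖Complex.exp (2 * Real.pi * Complex.I * θ) ^ (n + 1) - 1‖⁻¹ * Real.exp (K n) ≤
        Real.exp (K (n + 1)) := by
  set l : ℂ := Complex.exp (2 * Real.pi * Complex.I * θ) with hl
  have hl1 : ‖l‖ = 1 := norm_exp_two_pi_mul_I_mul θ
  have hq : ∀ k, (0 : ℝ) < qden a k := fun k => by exact_mod_cast hθ.qden_pos k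
  have hlog : ∀ k, 0 ≤ Real.log (qden a k) := fun k =>
    Real.log_nonneg (by exact_mod_cast hθ.qden_pos k)
  have hterm : ∀ k, 0 ≤ Real.log (qden a (k + 1)) / qden a k := fun k =>
    div_nonneg (hlog _) (hq k).le
  have hsum : Summable fun k => Real.log (qden a (k + 1)) / qden a k := by
    have := ENNReal.summable_toReal hB.ne
    simpa only [ENNReal.toReal_ofReal (hterm _)] using this
  have hsmall : ∀ k d, 0 < d → ‖l ^ d - 1‖ < 2 / (qden a k : ℝ) → qden a k ≤ 2 * d := by
    intro k d hd hlt
    by_contra! hcon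
    exact absurd (hθ.two_div_qden_le_norm_pow_sub_one k d hd hcon.le) (not_le.2 hlt)
  have hpos : ∀ n, 0 < ‖l ^ (n + 1) - 1‖ := fun n =>
    norm_pos_iff.2 (sub_ne_zero.2 (hθ.exp_pow_succ_ne_one n))
  let S : ℕ → Set ℕ := fun k => {n | 0 < n ∧ ‖l ^ n - 1‖ < 1 / (qden a k : ℝ)}
  have hS : ∀ k, ∀ s ∈ S k, qden a k ≤ 2 * s := by
    intro k s hs
    refine hsmall k s hs.1 (hs.2.trans ?_)
    exact (div_lt_div_iff_of_pos_right (hq k)).2 one_lt_two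
  have hSS : ∀ k, ∀ s ∈ S k, ∀ t ∈ S k, s < t → qden a k ≤ 2 * (t - s) := by
    intro k s hs t ht hst
    refine hsmall k (t - s) (Nat.sub_pos_of_lt hst) ?_
    have e : l ^ s * (l ^ (t - s) - 1) = (l ^ t - 1) - (l ^ s - 1) := by
      rw [mul_sub, ← pow_add, Nat.add_sub_cancel' hst.le]
      ring
    have e2 : ‖l ^ (t - s) - 1‖ = ‖(l ^ t - 1) - (l ^ s - 1)‖ := by
      rw [← e, norm_mul, norm_pow, hl1, one_pow, one_mul]
    rw [e2]
    calc ‖(l ^ t - 1) - (l ^ s - 1)‖ ≤ ‖l ^ t - 1‖ + ‖l ^ s - 1‖ := norm_sub_le _ _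
      _ < 1 / (qden a k : ℝ) + 1 / (qden a k : ℝ) := add_lt_add ht.2 hs.2
      _ = 2 / (qden a k : ℝ) := by ring
  let u : ℕ → ℕ → ℝ := fun n k =>
    davieCount (S k) (qden a k) n * (Real.log (qden a (k + 1)) / qden a k)
  have hu0 : ∀ n k, 0 ≤ u n k := fun n k => mul_nonneg (Nat.cast_nonneg _) (hterm k)
  have hule : ∀ n k, u n k ≤ 4 * n * (Real.log (qden a (k + 1)) / qden a k) := fun n k =>
    mul_le_mul_of_nonneg_right (by exact_mod_cast davieCount_le n) (hterm k)
  have hus : ∀ n, Summable (u n) := fun n =>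
    Summable.of_nonneg_of_le (hu0 n) (hule n) (hsum.mul_left _)
  refine ⟨fun n => ∑' k, u n k, 4 * ∑' k, Real.log (qden a (k + 1)) / qden a k,
    fun n => tsum_nonneg (hu0 n), fun n => ?_, fun m n => ?_, fun n => ?_⟩
  · calc ∑' k, u n k ≤ ∑' k, 4 * n * (Real.log (qden a (k + 1)) / qden a k) :=
          (hus n).tsum_le_tsum (hule n) (hsum.mul_left _)
      _ = _ := by rw [tsum_mul_left]; ring
  · rw [← (hus m).tsum_add (hus n)]
    refine ((hus m).add (hus n)).tsum_le_tsum (fun k => ?_) (hus _)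
    rw [← add_mul]
    exact mul_le_mul_of_nonneg_right
      (by exact_mod_cast davieCount_add_le (hθ.qden_pos k) m n) (hterm k)
  · have hmono : ∀ k, u n k ≤ u (n + 1) k := fun k =>
      mul_le_mul_of_nonneg_right
        (by exact_mod_cast davieCount_le_succ (hθ.qden_pos k) n) (hterm k)
    have hex : ∃ k, n + 1 ∉ S k := by
      obtain ⟨k, hk⟩ := exists_nat_ge (‖l ^ (n + 1) - 1‖⁻¹)
      refine ⟨k, fun hmem => not_le.2 hmem.2 ?_⟩
      have hk' : ‖l ^ (n + 1) - 1‖⁻¹ ≤ qden a k :=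
        hk.trans (by exact_mod_cast hθ.self_le_qden k)
      rw [one_div]
      exact inv_le_of_inv_le₀ (hpos n) hk'
    classical
    rcases hj : Nat.find hex with _ | j
    · have hn := Nat.find_spec hex
      rw [hj] at hn
      have h1 : 1 ≤ ‖l ^ (n + 1) - 1‖ := by
        by_contra! hcon
        exact hn ⟨n.succ_pos, by simpa [qden] using hcon⟩
      calc ‖l ^ (n + 1) - 1‖⁻¹ * Real.exp (∑' k, u n k)
          ≤ 1 * Real.exp (∑' k, u n k) :=
            mul_le_mul_of_nonneg_right (inv_le_one_of_one_le₀ h1) (Real.exp_pos _).le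
        _ ≤ _ := by
            rw [one_mul]
            exact Real.exp_le_exp.2 ((hus n).tsum_le_tsum hmono (hus _))
    · have hn := Nat.find_spec hex
      rw [hj] at hn
      have hmem : n + 1 ∈ S j := by
        have := Nat.find_min hex (m := j) (by omega)
        simpa using this
      have h1 : ‖l ^ (n + 1) - 1‖⁻¹ ≤ qden a (j + 1) := by
        by_contra! hcon
        refine hn ⟨n.succ_pos, ?_⟩
        rw [one_div]
        exact lt_inv_of_lt_inv₀ (hq _) hcon
      have hjump : u n j + Real.log (qden a (j + 1)) ≤ u (n + 1) j := by
        have h2 : (davieCount (S j) (qden a j) n : ℝ) + qden a j ≤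
            davieCount (S j) (qden a j) (n + 1) := by
          exact_mod_cast davieCount_add_le_succ (hθ.qden_pos j) (hS j) (hSS j) hmem
        have h3 := mul_le_mul_of_nonneg_right h2 (hterm j)
        rw [add_mul, mul_div_cancel₀ _ (hq j).ne'] at h3
        exact h3
      have hlogle : Real.log (qden a (j + 1)) + ∑' k, u n k ≤ ∑' k, u (n + 1) k := by
        rw [(hus n).tsum_eq_add_tsum_ite j, (hus (n + 1)).tsum_eq_add_tsum_ite j, ← add_assoc]
        refine add_le_add (by linarith) ?_
        have hs : ∀ m, Summable fun k => if k = j then 0 else u m k := fun m =>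
          Summable.of_nonneg_of_le (fun k => by split_ifs <;> [exact le_rfl; exact hu0 _ _])
            (fun k => by split_ifs <;> [exact hu0 _ _; exact le_rfl]) (hus m)
        refine (hs n).tsum_le_tsum (fun k => ?_) (hs (n + 1))
        split_ifs
        · exact le_rfl
        · exact hmono k
      calc ‖l ^ (n + 1) - 1‖⁻¹ * Real.exp (∑' k, u n k)
          ≤ Real.exp (Real.log (qden a (j + 1))) * Real.exp (∑' k, u n k) := by
            rw [Real.exp_log (hq _)]
            exact mul_le_mul_of_nonneg_right h1 (Real.exp_pos _).le
        _ ≤ _ := by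
            rw [← Real.exp_add]
            exact Real.exp_le_exp.2 hlogle

/-- The coefficients of the formal power series `ψ` with `ψ'(0) = 1` and `f ∘ ψ = ψ ∘ (l • ·)`, where
`c` are the coefficients of `f`. -/
noncomputable def linearizationCoeff (c : ℕ → ℂ) (l : ℂ) : ℕ → ℂ
  | 0 => 0
  | 1 => 1
  | n + 2 => (l ^ (n + 2) - l)⁻¹ * ∑ d ∈ {d : Composition (n + 2) | 1 < d.length}.toFinset,
      c d.length * ∏ j, if _ : d.blocksFun j < n + 2 then
        linearizationCoeff c l (d.blocksFun j) else 0

theorem Composition.blocksFun_lt_of_one_lt_length {n : ℕ} (hn : 0 < n) {d : Composition n}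
    (hd : 1 < d.length) (j : Fin d.length) : d.blocksFun j < n := by
  revert j
  rw [← Composition.ne_single_iff hn, Ne, Composition.eq_single_iff_length]
  exact hd.ne'

theorem linearizationCoeff_of_two_le (c : ℕ → ℂ) (l : ℂ) {n : ℕ} (hn : 2 ≤ n) :
    linearizationCoeff c l n =
      (l ^ n - l)⁻¹ * ∑ d ∈ {d : Composition n | 1 < d.length}.toFinset,
        c d.length * ∏ j, linearizationCoeff c l (d.blocksFun j) := by
  obtain ⟨n, rfl⟩ := Nat.exists_eq_add_of_le' hn
  rw [linearizationCoeff]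
  congr 1
  refine Finset.sum_congr rfl fun d hd => ?_
  congr 1
  refine Finset.prod_congr rfl fun j _ => ?_
  exact dif_pos (Composition.blocksFun_lt_of_one_lt_length (by omega) (by simpa using hd) j)

theorem superadditive_sum_le {K : ℕ → ℝ} (hK0 : ∀ n, 0 ≤ K n)
    (hK : ∀ m n, K m + K n ≤ K (m + n)) {ι : Type*} (s : Finset ι) (g : ι → ℕ) :
    ∑ i ∈ s, K (g i) ≤ K (∑ i ∈ s, g i) := by
  classical
  induction s using Finset.induction_on with
  | empty => simpa using hK0 0
  | insert i s hi ih =>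
    rw [Finset.sum_insert hi, Finset.sum_insert hi]
    exact (add_le_add_right ih _).trans (hK _ _)

theorem superadditive_mono {K : ℕ → ℝ} (hK0 : ∀ n, 0 ≤ K n)
    (hK : ∀ m n, K m + K n ≤ K (m + n)) : Monotone K := by
  intro m n hmn
  have := hK m (n - m)
  rw [Nat.add_sub_cancel' hmn] at this
  linarith [hK0 (n - m)]

theorem Composition.sum_blocksFun_sub_one {n : ℕ} (d : Composition n) :
    ∑ j, (d.blocksFun j - 1) = n - d.length := by
  have h1 : ∑ j, (d.blocksFun j - 1) + d.length = n := by
    calc ∑ j, (d.blocksFun j - 1) + d.length = ∑ j, ((d.blocksFun j - 1) + 1) := by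
          rw [Finset.sum_add_distrib]; simp
      _ = ∑ j, d.blocksFun j :=
          Finset.sum_congr rfl fun j _ => Nat.sub_add_cancel (d.one_le_blocksFun j)
      _ = n := d.sum_blocksFun
  omega

section Growth

variable {c : ℕ → ℂ} {l : ℂ} {K : ℕ → ℝ} {r : ℝ}

/-- The small divisors are absorbed by the superadditive function `K`, leaving a
majorant recursion without small divisors. -/
theorem norm_linearizationCoeff_mul_exp_le (hl : ‖l‖ = 1) (hK0 : ∀ n, 0 ≤ K n)
    (hK : ∀ m n, K m + K n ≤ K (m + n))
    (hKl : ∀ n, ‖l ^ (n + 1) - 1‖⁻¹ * Real.exp (K n) ≤ Real.exp (K (n + 1)))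
    (hc : ∀ n, 2 ≤ n → ‖c n‖ ≤ r ^ n) {n : ℕ} (hn : 2 ≤ n) :
    ‖linearizationCoeff c l n‖ * Real.exp (-K (n - 1)) ≤
      ∑ d ∈ {d : Composition n | 1 < d.length}.toFinset, r ^ d.length *
        ∏ j, (‖linearizationCoeff c l (d.blocksFun j)‖ * Real.exp (-K (d.blocksFun j - 1))) := by
  have hdiv : ‖(l ^ n - l)⁻¹‖ * Real.exp (K (n - 2)) ≤ Real.exp (K (n - 1)) := by
    have e : ‖l ^ n - l‖ = ‖l ^ (n - 2 + 1) - 1‖ := by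
      have : l ^ n - l = l * (l ^ (n - 2 + 1) - 1) := by
        rw [mul_sub, ← pow_succ', mul_one]
        congr 2
        omega
      rw [this, norm_mul, hl, one_mul]
    have := hKl (n - 2)
    rwa [← e, show n - 2 + 1 = n - 1 by omega, ← norm_inv] at this
  have hfac : ‖(l ^ n - l)⁻¹‖ * Real.exp (-K (n - 1)) ≤ Real.exp (-K (n - 2)) := by
    have := mul_le_mul_of_nonneg_right hdiv
      (mul_pos (Real.exp_pos (-K (n - 1))) (Real.exp_pos (-K (n - 2)))).le
    calc ‖(l ^ n - l)⁻¹‖ * Real.exp (-K (n - 1))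
        = ‖(l ^ n - l)⁻¹‖ * Real.exp (K (n - 2)) *
            (Real.exp (-K (n - 1)) * Real.exp (-K (n - 2))) := by
          rw [Real.exp_neg (K (n - 2))]
          field_simp
      _ ≤ _ := this
      _ = _ := by
          rw [Real.exp_neg (K (n - 1))]
          field_simp
  rw [linearizationCoeff_of_two_le c l hn, norm_mul, mul_right_comm]
  calc ‖(l ^ n - l)⁻¹‖ * Real.exp (-K (n - 1)) *
        ‖∑ d ∈ {d : Composition n | 1 < d.length}.toFinset,
          c d.length * ∏ j, linearizationCoeff c l (d.blocksFun j)‖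
      ≤ Real.exp (-K (n - 2)) * ∑ d ∈ {d : Composition n | 1 < d.length}.toFinset,
          ‖c d.length * ∏ j, linearizationCoeff c l (d.blocksFun j)‖ :=
        mul_le_mul hfac (norm_sum_le _ _) (norm_nonneg _) (Real.exp_pos _).le
    _ ≤ _ := by
        rw [Finset.mul_sum]
        refine Finset.sum_le_sum fun d hd => ?_
        have hd : 1 < d.length := by simpa using hd
        rw [norm_mul, norm_prod, Finset.prod_mul_distrib, ← Real.exp_sum, Finset.sum_neg_distrib]
        have h1 : ∑ j, K (d.blocksFun j - 1) ≤ K (n - 2) :=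
          (superadditive_sum_le hK0 hK _ _).trans <| by
            rw [d.sum_blocksFun_sub_one]
            exact superadditive_mono hK0 hK (by omega)
        have hP : 0 ≤ ∏ j, ‖linearizationCoeff c l (d.blocksFun j)‖ :=
          Finset.prod_nonneg fun _ _ => norm_nonneg _
        calc Real.exp (-K (n - 2)) *
              (‖c d.length‖ * ∏ j, ‖linearizationCoeff c l (d.blocksFun j)‖)
            ≤ Real.exp (-∑ j, K (d.blocksFun j - 1)) *
              (r ^ d.length * ∏ j, ‖linearizationCoeff c l (d.blocksFun j)‖) :=
              mul_le_mul (Real.exp_le_exp.2 (neg_le_neg h1))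
                (mul_le_mul_of_nonneg_right (hc _ hd) hP)
                (mul_nonneg (norm_nonneg _) hP) (Real.exp_pos _).le
          _ = _ := by ring

theorem sum_pow_mul_linearizationCoeff_le (hl : ‖l‖ = 1) (hK0 : ∀ n, 0 ≤ K n)
    (hK : ∀ m n, K m + K n ≤ K (m + n))
    (hKl : ∀ n, ‖l ^ (n + 1) - 1‖⁻¹ * Real.exp (K n) ≤ Real.exp (K (n + 1)))
    (hc : ∀ n, 2 ≤ n → ‖c n‖ ≤ r ^ n) (hr : 1 ≤ r) {a : ℝ} (ha : a = 1 / (8 * r ^ 2)) (n : ℕ) :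
    ∑ k ∈ Finset.Ico 1 n,
      a ^ k * (‖linearizationCoeff c l k‖ * Real.exp (-K (k - 1))) ≤ 2 * a := by
  have ha0 : 0 < a := by rw [ha]; positivity
  have hra : 8 * r ^ 2 * a = 1 := by rw [ha]; field_simp
  set p : ℕ → ℝ := fun k => ‖linearizationCoeff c l k‖ * Real.exp (-K (k - 1)) with hp
  have hp0 : ∀ k, 0 ≤ p k := fun k => mul_nonneg (norm_nonneg _) (Real.exp_pos _).le
  have hp1 : p 1 ≤ 1 := by
    simpa [hp, linearizationCoeff] using hK0 0
  change ∑ k ∈ Finset.Ico 1 n, a ^ k * p k ≤ 2 * a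
  induction n with
  | zero => simpa using ha0.le
  | succ n ih =>
    rcases Nat.eq_zero_or_pos n with rfl | hn
    · simpa using ha0.le
    set s := ∑ k ∈ Finset.Ico 1 n, a ^ k * p k with hs
    have hs0 : 0 ≤ s := Finset.sum_nonneg fun k _ => mul_nonneg (pow_nonneg ha0.le _) (hp0 k)
    have hx0 : 0 ≤ r * s := mul_nonneg (by linarith) hs0
    have hx : r * s ≤ 2 * r * a := by nlinarith
    have hx2 : r * s ≤ 1 / 2 := by nlinarith
    have htail : ∑ j ∈ Finset.Ico 2 (n + 1), r ^ j * s ^ j ≤ 2 * (r * s) ^ 2 := by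
      calc ∑ j ∈ Finset.Ico 2 (n + 1), r ^ j * s ^ j
          = ∑ j ∈ Finset.Ico 2 (n + 1), (r * s) ^ j := by simp_rw [mul_pow]
        _ ≤ (r * s) ^ 2 / (1 - r * s) := geom_sum_Ico_le_of_lt_one hx0 (by linarith)
        _ ≤ 2 * (r * s) ^ 2 := by
            rw [div_le_iff₀ (by linarith)]
            nlinarith [sq_nonneg (r * s)]
    have hsq : (r * s) ^ 2 ≤ (2 * r * a) ^ 2 := pow_le_pow_left₀ hx0 hx 2
    calc ∑ k ∈ Finset.Ico 1 (n + 1), a ^ k * p k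
        = a * p 1 + ∑ k ∈ Finset.Ico 2 (n + 1), a ^ k * p k := by
          rw [Finset.sum_eq_sum_Ico_succ_bot (by omega), pow_one]
      _ ≤ a * 1 + ∑ k ∈ Finset.Ico 2 (n + 1), a ^ k *
            ∑ d ∈ {d : Composition k | 1 < d.length}.toFinset,
              r ^ d.length * ∏ j, p (d.blocksFun j) := by
          refine add_le_add (mul_le_mul_of_nonneg_left hp1 ha0.le)
            (Finset.sum_le_sum fun k hk => ?_)
          exact mul_le_mul_of_nonneg_left
            (norm_linearizationCoeff_mul_exp_le hl hK0 hK hKl hc (Finset.mem_Ico.1 hk).1)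
            (pow_nonneg ha0.le _)
      _ ≤ a * 1 + ∑ j ∈ Finset.Ico 2 (n + 1), r ^ j * s ^ j :=
          add_le_add le_rfl (FormalMultilinearSeries.radius_right_inv_pos_of_radius_pos_aux1
            n p hp0 (by linarith) ha0.le)
      _ ≤ 2 * a := by nlinarith

theorem radius_ofScalars_linearizationCoeff_pos (hl : ‖l‖ = 1) (hK0 : ∀ n, 0 ≤ K n)
    {M : ℝ} (hKM : ∀ n, K n ≤ M * n) (hK : ∀ m n, K m + K n ≤ K (m + n))
    (hKl : ∀ n, ‖l ^ (n + 1) - 1‖⁻¹ * Real.exp (K n) ≤ Real.exp (K (n + 1)))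
    (hc : ∀ n, 2 ≤ n → ‖c n‖ ≤ r ^ n) (hr : 1 ≤ r) :
    0 < (FormalMultilinearSeries.ofScalars ℂ (linearizationCoeff c l)).radius := by
  obtain ⟨a, ha⟩ : ∃ a, a = 1 / (8 * r ^ 2) := ⟨_, rfl⟩
  have ha0 : 0 < a := by rw [ha]; positivity
  have hρ : 0 < a * Real.exp (-M) := mul_pos ha0 (Real.exp_pos _)
  refine lt_of_lt_of_le ?_ (FormalMultilinearSeries.le_radius_of_bound _ (2 * a)
    (r := (a * Real.exp (-M)).toNNReal) fun n => ?_)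
  · simpa using hρ
  rw [Real.coe_toNNReal _ hρ.le, FormalMultilinearSeries.ofScalars_norm]
  rcases Nat.eq_zero_or_pos n with rfl | hn
  · simpa [linearizationCoeff] using ha0.le
  have h1 := sum_pow_mul_linearizationCoeff_le hl hK0 hK hKl hc hr ha (n + 1)
  have h2 := Finset.single_le_sum (s := Finset.Ico 1 (n + 1))
    (f := fun k => a ^ k * (‖linearizationCoeff c l k‖ * Real.exp (-K (k - 1))))
    (fun k _ => mul_nonneg (pow_nonneg ha0.le _) (mul_nonneg (norm_nonneg _) (Real.exp_pos _).le))
    (Finset.mem_Ico.2 ⟨hn, n.lt_succ_self⟩)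
  refine le_trans ?_ (h2.trans h1)
  have h3 : Real.exp (-M) ^ n ≤ Real.exp (-K (n - 1)) := by
    rw [← Real.exp_nat_mul]
    refine Real.exp_le_exp.2 ?_
    have := (superadditive_mono hK0 hK (Nat.sub_le n 1)).trans (hKM n)
    linarith
  calc ‖linearizationCoeff c l n‖ * (a * Real.exp (-M)) ^ n
      = a ^ n * (‖linearizationCoeff c l n‖ * Real.exp (-M) ^ n) := by ring
    _ ≤ _ := mul_le_mul_of_nonneg_left (mul_le_mul_of_nonneg_left h3 (norm_nonneg _))
        (pow_nonneg ha0.le _)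

end Growth

theorem comp_ofScalars_linearizationCoeff (p : FormalMultilinearSeries ℂ ℂ ℂ) {l : ℂ}
    (hp0 : p.coeff 0 = 0) (hp1 : p.coeff 1 = l) (hl : ∀ n, l ^ (n + 2) - l ≠ 0) :
    p.comp (FormalMultilinearSeries.ofScalars ℂ (linearizationCoeff p.coeff l)) =
      (FormalMultilinearSeries.ofScalars ℂ (linearizationCoeff p.coeff l)).compContinuousLinearMap
        (l • ContinuousLinearMap.id ℂ ℂ) := by
  set b := linearizationCoeff p.coeff l with hb
  set q := FormalMultilinearSeries.ofScalars ℂ b with hq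
  have hqc : ∀ n, q.coeff n = b n := fun n => FormalMultilinearSeries.coeff_ofScalars
  refine FormalMultilinearSeries.ext fun n => ContinuousMultilinearMap.ext fun v => ?_
  rcases Nat.eq_zero_or_pos n with rfl | hn
  · rw [FormalMultilinearSeries.comp_coeff_zero',
      FormalMultilinearSeries.compContinuousLinearMap_apply,
      FormalMultilinearSeries.apply_eq_prod_smul_coeff,
      FormalMultilinearSeries.apply_eq_prod_smul_coeff, hqc, hp0, hb, linearizationCoeff]
    simp
  have hR : q.compContinuousLinearMap (l • ContinuousLinearMap.id ℂ ℂ) n v =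
      (∏ i, v i) * (l ^ n * b n) := by
    rw [FormalMultilinearSeries.compContinuousLinearMap_apply,
      FormalMultilinearSeries.apply_eq_prod_smul_coeff, hqc]
    simp [Finset.prod_mul_distrib]
    ring
  rw [hR, FormalMultilinearSeries.comp_rightInv_aux1 hn]
  have hterm : ∀ d : Composition n, p d.length (q.applyComposition d v) =
      (∏ i, v i) * (p.coeff d.length * ∏ j, b (d.blocksFun j)) := by
    intro d
    rw [FormalMultilinearSeries.apply_eq_prod_smul_coeff]
    have : ∏ j, q.applyComposition d v j = (∏ i, v i) * ∏ j, b (d.blocksFun j) := by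
      have e : ∀ j, q.applyComposition d v j =
          (∏ i, v (d.embedding j i)) * b (d.blocksFun j) := by
        intro j
        rw [FormalMultilinearSeries.applyComposition,
          FormalMultilinearSeries.apply_eq_prod_smul_coeff, hqc]
        simp
      simp_rw [e]
      rw [Finset.prod_mul_distrib]
      congr 1
      rw [← d.blocksFinEquiv.prod_comp, Fintype.prod_sigma]
      rfl
    rw [this, smul_eq_mul]
    ring
  have hlin : (p 1 fun _ => q n v) = (∏ i, v i) * (l * b n) := by
    rw [FormalMultilinearSeries.apply_eq_prod_smul_coeff, hp1,
      FormalMultilinearSeries.apply_eq_prod_smul_coeff, hqc]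
    simp
    ring
  rw [hlin, Finset.sum_congr rfl fun d _ => hterm d, ← Finset.mul_sum, ← mul_add]
  congr 1
  rcases Nat.lt_or_ge n 2 with h | h
  · obtain rfl : n = 1 := by omega
    have hempty : ({d : Composition 1 | 1 < d.length}.toFinset) = ∅ := by
      ext d
      simp
    rw [hempty]
    simp
  · obtain ⟨n, rfl⟩ := Nat.exists_eq_add_of_le' h
    have := linearizationCoeff_of_two_le p.coeff l h
    rw [← hb] at this
    rw [inv_mul_eq_div, eq_div_iff (hl n)] at this
    linear_combination -this

/-- An analytic germ with a small divisor estimate of Davie type is linearizable. -/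
theorem exists_linearization {l : ℂ} (hl : ‖l‖ = 1) (hl1 : ∀ n : ℕ, l ^ (n + 1) ≠ 1) {K : ℕ → ℝ}
    {M : ℝ} (hK0 : ∀ n, 0 ≤ K n) (hKM : ∀ n, K n ≤ M * n) (hK : ∀ m n, K m + K n ≤ K (m + n))
    (hKl : ∀ n, ‖l ^ (n + 1) - 1‖⁻¹ * Real.exp (K n) ≤ Real.exp (K (n + 1)))
    {f : ℂ → ℂ} (hf : AnalyticAt ℂ f 0) (hf0 : f 0 = 0) (hf' : deriv f 0 = l) :
    ∃ r : ℝ, 0 < r ∧ ∃ ψ : ℂ → ℂ,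
      DifferentiableOn ℂ ψ (Metric.ball 0 r) ∧ Set.InjOn ψ (Metric.ball 0 r) ∧
      ψ 0 = 0 ∧ deriv ψ 0 = 1 ∧
      ∀ z ∈ Metric.ball (0 : ℂ) r, f (ψ z) = ψ (l * z) := by
  obtain ⟨p, hp⟩ := hf
  have hp0 : p.coeff 0 = 0 := by
    rw [← hf0, ← hp.coeff_zero 1]
    rfl
  have hp1 : p.coeff 1 = l := by
    rw [← hf', hp.hasDerivAt.deriv]
    simp
  obtain ⟨C, ρ, hC, hρ, hCρ⟩ := p.le_mul_pow_of_radius_pos hp.radius_pos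
  obtain ⟨r, hr⟩ : ∃ r, r = max 1 C * max 1 ρ := ⟨_, rfl⟩
  have hr1 : 1 ≤ r := by
    rw [hr]
    exact one_le_mul_of_one_le_of_one_le (le_max_left _ _) (le_max_left _ _)
  have hc : ∀ n, 2 ≤ n → ‖p.coeff n‖ ≤ r ^ n := by
    intro n hn
    rw [← FormalMultilinearSeries.norm_apply_eq_norm_coef, hr, mul_pow]
    refine (hCρ n).trans (mul_le_mul ?_ ?_ (pow_nonneg hρ.le _) (by positivity))
    · exact (le_max_right 1 C).trans (le_self_pow₀ (le_max_left _ _) (by omega))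
    · exact pow_le_pow_left₀ hρ.le (le_max_right _ _) n
  set q := FormalMultilinearSeries.ofScalars ℂ (linearizationCoeff p.coeff l) with hq
  have hqr : 0 < q.radius := radius_ofScalars_linearizationCoeff_pos hl hK0 hKM hK hKl hc hr1
  have hψ : HasFPowerSeriesAt q.sum q 0 := (q.hasFPowerSeriesOnBall hqr).hasFPowerSeriesAt
  have hψ0 : q.sum 0 = 0 := by
    rw [← hψ.coeff_zero 1]
    change q.coeff 0 = 0
    rw [FormalMultilinearSeries.coeff_ofScalars, linearizationCoeff]
  have hψ1 : HasStrictDerivAt q.sum 1 0 := by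
    have h := hψ.hasStrictDerivAt
    have e : q 1 (fun _ => 1) = 1 := by
      change q.coeff 1 = 1
      rw [FormalMultilinearSeries.coeff_ofScalars, linearizationCoeff]
    rwa [e] at h
  have hcomp : p.comp q = q.compContinuousLinearMap (l • ContinuousLinearMap.id ℂ ℂ) := by
    refine comp_ofScalars_linearizationCoeff p hp0 hp1 fun n hn => hl1 n ?_
    have hl0 : l ≠ 0 := by
      rintro rfl
      simp at hl
    refine mul_left_cancel₀ hl0 ?_
    rw [mul_one, ← pow_succ']
    exact sub_eq_zero.1 hn
  have hleft : HasFPowerSeriesAt (f ∘ q.sum) (p.comp q) 0 :=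
    HasFPowerSeriesAt.comp (by rwa [hψ0]) hψ
  have hright : HasFPowerSeriesAt (q.sum ∘ (l • ContinuousLinearMap.id ℂ ℂ)) (p.comp q) 0 := by
    rw [hcomp]
    exact HasFPowerSeriesAt.compContinuousLinearMap (by simpa using hψ)
  have heq : ∀ᶠ z in nhds (0 : ℂ), f (q.sum z) = q.sum (l * z) := by
    filter_upwards [hleft.eventually_hasSum, hright.eventually_hasSum] with z h1 h2
    simpa using h1.unique h2
  have hinj : ∃ s ∈ nhds (0 : ℂ), Set.InjOn q.sum s := by
    let e := hψ1.hasStrictFDerivAt_equiv one_ne_zero |>.toOpenPartialHomeomorph q.sum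
    exact ⟨e.source, e.open_source.mem_nhds
      (HasStrictFDerivAt.mem_toOpenPartialHomeomorph_source _), e.injOn⟩
  obtain ⟨s, hs, hinj⟩ := hinj
  have hdiff : ∀ᶠ z in nhds (0 : ℂ), AnalyticAt ℂ q.sum z := hψ.analyticAt.eventually_analyticAt
  obtain ⟨ε, hε, hball⟩ := Metric.eventually_nhds_iff_ball.1 (heq.and (hdiff.and hs))
  exact ⟨ε, hε, q.sum, fun z hz => (hball z hz).2.1.differentiableAt.differentiableWithinAt,
    hinj.mono fun z hz => (hball z hz).2.2, hψ0, hψ1.hasDerivAt.deriv, fun z hz => (hball z hz).1⟩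

/-- Brjuno's theorem: if `θ` is a Brjuno number (i.e. `Σ_n log(q_{n+1})/q_n < ∞`) and `f` is
holomorphic near `0` with `f(0) = 0` and `f'(0) = e^{2πiθ}`, then `f` is linearizable at `0`. -/
theorem brjuno_linearizable
    (θ : ℝ) (a : ℕ → ℕ) (hθ : HasCF θ a)
    (hB : (∑' k : ℕ, ENNReal.ofReal (Real.log (qden a (k + 1)) / qden a k)) < ⊤)
    (f : ℂ → ℂ) (hf : AnalyticAt ℂ f 0) (hf0 : f 0 = 0)
    (hf' : deriv f 0 = Complex.exp (2 * Real.pi * Complex.I * θ)) :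
    ∃ r : ℝ, 0 < r ∧ ∃ ψ : ℂ → ℂ,
      DifferentiableOn ℂ ψ (Metric.ball 0 r) ∧ Set.InjOn ψ (Metric.ball 0 r) ∧
      ψ 0 = 0 ∧ deriv ψ 0 = 1 ∧
      ∀ z ∈ Metric.ball (0 : ℂ) r,
        f (ψ z) = ψ (Complex.exp (2 * Real.pi * Complex.I * θ) * z) := by
  have hl1 : ‖Complex.exp (2 * Real.pi * Complex.I * θ)‖ = 1 := norm_exp_two_pi_mul_I_mul θ
  obtain ⟨K, M, hK0, hKM, hK, hKl⟩ := exists_davie_function θ a hθ hB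
  exact exists_linearization hl1 (fun n => hθ.exp_pow_succ_ne_one n) hK0 hKM hK hKl hf hf0 hf'
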